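/- arXiv:1711.09228 — 2 statements merged into one kernel-verified Lean document; each statement's English description precedes it below -/
import Mathlib

section
/- Let m ≥ 1 be a natural number, α real with m − 1 < α < m, and let f : ℝ → ℝ be m-times continuously differentiable on [0,1]. Define F(s) = (1/Γ(α)) ∫_0^s (s−t)^{α−1} f(t) dt. Then F is m-times differentiable on (0,1] and for every x ∈ (0,1], (1/Γ(m−α)) ∫_0^x (x−t)^{m−α−1} F^{(m)}(t) dt = f(x). -/
open MeasureTheory Set Filter Topology

noncomputable def phi (ν : ℝ) : ℝ → ℝ := (Ioi (0:ℝ)).indicator (fun t => t ^ (ν - 1) / Real.Gamma ν)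

noncomputable def Jf (ν : ℝ) (g : ℝ → ℝ) (x : ℝ) : ℝ :=
  (1 / Real.Gamma ν) * ∫ t in (0 : ℝ)..x, (x - t) ^ (ν - 1) * g t

noncomputable abbrev ml : ℝ →L[ℝ] ℝ →L[ℝ] ℝ := ContinuousLinearMap.mul ℝ ℝ

noncomputable abbrev ind (g : ℝ → ℝ) : ℝ → ℝ := (Ioi (0:ℝ)).indicator g

open scoped Convolution

lemma phi_of_pos {ν t : ℝ} (ht : 0 < t) : phi ν t = t ^ (ν - 1) / Real.Gamma ν := by
  simp [phi, ht]

lemma phi_nonneg {ν : ℝ} (hν : 0 < ν) (t : ℝ) : 0 ≤ phi ν t := by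
  unfold phi
  refine indicator_nonneg (fun t ht => ?_) t
  have := Real.Gamma_pos_of_pos hν
  have : 0 < t := ht
  positivity

lemma phi_meas (ν : ℝ) : Measurable (phi ν) := by
  unfold phi
  exact (by fun_prop : Measurable fun t : ℝ => t ^ (ν - 1) / Real.Gamma ν).indicator measurableSet_Ioi

lemma conv_nonpos (g h : ℝ → ℝ) {x : ℝ} (hx : x ≤ 0) : (ind g ⋆[ml] ind h) x = 0 := by
  rw [convolution_def]
  refine integral_eq_zero_of_ae (Eventually.of_forall fun t => ?_)
  by_cases ht : 0 < t
  · have : ¬ (0 < x - t) := by linarith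
    simp [this]
  · simp [ht]

lemma conv_int (ν : ℝ) (g : ℝ → ℝ) (x t : ℝ) :
    phi ν t * ind g (x - t)
      = (Ioo 0 x).indicator (fun t => (1 / Real.Gamma ν) * (t ^ (ν-1) * g (x - t))) t := by
  by_cases ht : 0 < t <;> by_cases h2 : t < x <;> simp [phi, ind, indicator, ht, h2] <;> ring

lemma conv_eq (ν : ℝ) (g : ℝ → ℝ) : phi ν ⋆[ml] ind g = ind (Jf ν g) := by
  ext x
  by_cases hx : 0 < x
  · rw [convolution_def]
    simp only [ml, ContinuousLinearMap.mul_apply', conv_int]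
    rw [integral_indicator measurableSet_Ioo, ← integral_Ioc_eq_integral_Ioo,
      ← intervalIntegral.integral_of_le hx.le, intervalIntegral.integral_const_mul]
    have := intervalIntegral.integral_comp_sub_left (a := 0) (b := x)
      (fun t => (x - t) ^ (ν-1) * g t) x
    simp only [sub_sub_cancel, sub_self, sub_zero] at this
    rw [this]
    simp [ind, Jf, hx]
  · rw [phi, conv_nonpos _ _ (not_lt.1 hx)]
    simp [ind, hx]

lemma beta_real {a b x : ℝ} (ha : 0 < a) (hb : 0 < b) (hx : 0 < x) :
    ∫ t in (0:ℝ)..x, t ^ (a-1) * (x - t) ^ (b-1)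
      = x ^ (a + b - 1) * (Real.Gamma a * Real.Gamma b / Real.Gamma (a+b)) := by
  have h := Complex.betaIntegral_scaled (a : ℂ) (b : ℂ) hx
  rw [Complex.betaIntegral_eq_Gamma_mul_div _ _ (by simpa) (by simpa)] at h
  rw [← Complex.ofReal_inj, ← intervalIntegral.integral_ofReal]
  push_cast
  rw [Complex.ofReal_cpow hx.le, ← Complex.Gamma_ofReal, ← Complex.Gamma_ofReal,
    ← Complex.Gamma_ofReal]
  push_cast
  rw [← h]
  refine intervalIntegral.integral_congr fun t ht => ?_
  rw [uIcc_of_le hx.le] at ht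
  rw [Complex.ofReal_cpow ht.1, Complex.ofReal_cpow (sub_nonneg.2 ht.2)]
  push_cast
  rfl

lemma phi_conv {a b : ℝ} (ha : 0 < a) (hb : 0 < b) : phi a ⋆[ml] phi b = phi (a + b) := by
  ext x
  by_cases hx : 0 < x
  · have : phi b = ind (fun t => t ^ (b-1) / Real.Gamma b) := rfl
    rw [convolution_def]
    simp only [ml, ContinuousLinearMap.mul_apply', this, conv_int]
    rw [integral_indicator measurableSet_Ioo, ← integral_Ioc_eq_integral_Ioo,
      ← intervalIntegral.integral_of_le hx.le, intervalIntegral.integral_const_mul]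
    simp only [← mul_div_assoc]
    rw [intervalIntegral.integral_div, beta_real ha hb hx, phi_of_pos hx]
    have := Real.Gamma_pos_of_pos ha
    have := Real.Gamma_pos_of_pos hb
    field_simp
  · rw [phi, phi, conv_nonpos _ _ (not_lt.1 hx)]
    simp [phi, hx]

lemma phi_conv_exists {a b : ℝ} (ha : 0 < a) (hb : 0 < b) (x : ℝ) :
    ConvolutionExistsAt (phi a) (phi b) x ml := by
  by_cases hx : 0 < x
  · by_contra hc
    have h1 : (phi a ⋆[ml] phi b) x = 0 := integral_undef hc
    rw [phi_conv ha hb, phi_of_pos hx] at h1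
    have := Real.Gamma_pos_of_pos (add_pos ha hb)
    have : 0 < x ^ (a + b - 1) / Real.Gamma (a+b) := by positivity
    linarith
  · have : phi b = ind (fun t => t ^ (b-1) / Real.Gamma b) := rfl
    unfold ConvolutionExistsAt
    simp only [ml, ContinuousLinearMap.mul_apply', this, conv_int]
    rw [Ioo_eq_empty hx]
    simp

lemma conv_exists {ν : ℝ} (hν : 0 < ν) {h : ℝ → ℝ} (hh : ContinuousOn h (Ici 0)) (x : ℝ) :
    ConvolutionExistsAt (phi ν) (ind h) x ml := by
  unfold ConvolutionExistsAt
  simp only [ml, ContinuousLinearMap.mul_apply', conv_int]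
  rw [integrable_indicator_iff measurableSet_Ioo]
  by_cases hx : 0 < x
  · rw [← integrableOn_Ioc_iff_integrableOn_Ioo, ← intervalIntegrable_iff_integrableOn_Ioc_of_le hx.le]
    refine IntervalIntegrable.const_mul (IntervalIntegrable.mul_continuousOn
      (intervalIntegral.intervalIntegrable_rpow' (by linarith)) ?_) _
    refine hh.comp (by fun_prop) fun t ht => ?_
    rw [uIcc_of_le hx.le] at ht
    exact sub_nonneg.2 ht.2
  · rw [Ioo_eq_empty hx]; simp

lemma Jf_scaled {ν : ℝ} (hν : 0 < ν) (g : ℝ → ℝ) {x : ℝ} (hx : 0 ≤ x) :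
    Jf ν g x = (1 / Real.Gamma ν) * (x ^ ν * ∫ u in (0:ℝ)..1, (1 - u) ^ (ν - 1) * g (x * u)) := by
  rcases hx.eq_or_lt with rfl | hx
  · simp [Jf, Real.zero_rpow hν.ne']
  unfold Jf
  congr 1
  have := intervalIntegral.smul_integral_comp_mul_left (a := 0) (b := 1)
      (fun t : ℝ => (x - t) ^ (ν-1) * g t) x
  simp only [mul_zero, mul_one, smul_eq_mul] at this
  rw [← this]
  have h2 : x ^ ν = x * x ^ (ν - 1) := by
    rw [Real.rpow_sub_one hx.ne']; field_simp
  rw [h2, mul_assoc, ← intervalIntegral.integral_const_mul (x ^ (ν - 1))]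
  refine congrArg (x * ·) (intervalIntegral.integral_congr fun t ht => ?_)
  rw [uIcc_of_le zero_le_one] at ht
  rw [← mul_assoc, ← Real.mul_rpow hx.le (sub_nonneg.2 ht.2)]
  ring_nf

lemma Jf_cont {ν : ℝ} (hν : 0 < ν) {g : ℝ → ℝ} (hg : Continuous g) :
    ContinuousOn (Jf ν g) (Ici 0) := by
  have key : Continuous fun x : ℝ => ∫ u in (0:ℝ)..1, (1 - u) ^ (ν - 1) * g (x * u) := by
    rw [continuous_iff_continuousAt]
    intro x₀
    obtain ⟨C, hC⟩ := (isCompact_Icc (a := -(|x₀|+1)) (b := |x₀|+1)).exists_bound_of_continuousOn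
      hg.continuousOn
    have hii : IntervalIntegrable (fun u : ℝ => (1 - u) ^ (ν - 1)) volume 0 1 := by
      have := (intervalIntegral.intervalIntegrable_rpow' (a := 0) (b := 1) (r := ν - 1)
        (by linarith)).comp_sub_left 1
      simpa using this.symm
    refine intervalIntegral.continuousAt_of_dominated_interval
      (bound := fun u => (1 - u) ^ (ν - 1) * C) ?_ ?_ (hii.mul_const C) ?_
    · refine Eventually.of_forall fun x => ?_
      exact (by fun_prop : Measurable fun u : ℝ => (1 - u) ^ (ν - 1) * g (x * u)).aestronglyMeasurable
    · have : ∀ᶠ x in 𝓝 x₀, |x| < |x₀| + 1 :=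
        (continuous_abs.tendsto x₀).eventually_lt_const (by linarith)
      filter_upwards [this] with x hx
      refine Eventually.of_forall fun u hu => ?_
      rw [uIoc_of_le zero_le_one] at hu
      have h1 : 0 ≤ (1 - u) ^ (ν - 1) := Real.rpow_nonneg (sub_nonneg.2 hu.2) _
      rw [norm_mul, Real.norm_of_nonneg h1]
      refine mul_le_mul_of_nonneg_left (hC _ ?_) h1
      rw [mem_Icc, ← abs_le, abs_mul, abs_of_pos hu.1]
      nlinarith [abs_nonneg x, hu.1, hu.2]
    · refine Eventually.of_forall fun u hu => ?_
      fun_prop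
  have h2 : Continuous fun x : ℝ => x ^ ν := Real.continuous_rpow_const hν.le
  have h3 : Continuous fun x : ℝ =>
      (1 / Real.Gamma ν) * (x ^ ν * ∫ u in (0:ℝ)..1, (1 - u) ^ (ν - 1) * g (x * u)) := by
    exact continuous_const.mul (h2.mul key)
  exact h3.continuousOn.congr fun x hx => Jf_scaled hν g hx

lemma semigroup_ind {a b : ℝ} (ha : 0 < a) (hb : 0 < b) {g : ℝ → ℝ} (hg : Continuous g) (x : ℝ) :
    (phi a ⋆[ml] (phi b ⋆[ml] ind g)) x = (phi (a + b) ⋆[ml] ind g) x := by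
  have hn : ∀ c : ℝ, 0 < c → (fun x => ‖phi c x‖) = phi c := fun c hc => by
    ext t; exact Real.norm_of_nonneg (phi_nonneg hc t)
  have hi : (fun x => ‖ind g x‖) = ind (fun t => |g t|) := by
    ext t
    by_cases ht : 0 < t <;> simp [ind, ht]
  have hga : Continuous fun t => |g t| := hg.abs
  rw [← phi_conv ha hb]
  symm
  refine convolution_assoc ml ml ml ml (fun x y z => by simp [mul_assoc]) 
    (phi_meas a).aestronglyMeasurable (phi_meas b).aestronglyMeasurable
    (hg.measurable.indicator measurableSet_Ioi).aestronglyMeasurable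
    (Eventually.of_forall fun y => phi_conv_exists ha hb y) ?_ ?_
  · rw [hn b hb, hi]
    exact Eventually.of_forall fun y => conv_exists hb hga.continuousOn y
  · rw [hn b hb, hi, hn a ha]
    rw [show (phi b ⋆[ContinuousLinearMap.mul ℝ ℝ] ind fun t => |g t|) = _ from conv_eq b _]
    exact conv_exists ha (Jf_cont hb hga) x

lemma Jf_eq_conv {ν x : ℝ} (hx : 0 < x) (g : ℝ → ℝ) : Jf ν g x = (phi ν ⋆[ml] ind g) x := by
  rw [conv_eq]; simp [ind, hx]

lemma semigroup {a b : ℝ} (ha : 0 < a) (hb : 0 < b) {g : ℝ → ℝ} (hg : Continuous g) {x : ℝ}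
    (hx : 0 < x) : Jf a (Jf b g) x = Jf (a + b) g x := by
  rw [Jf_eq_conv hx, Jf_eq_conv hx, ← conv_eq, semigroup_ind ha hb hg]

lemma Jf_one (g : ℝ → ℝ) (x : ℝ) : Jf 1 g x = ∫ t in (0:ℝ)..x, g t := by
  simp [Jf]

lemma Jf_deriv {ν : ℝ} (hν : 0 < ν) {g : ℝ → ℝ} (hg : Continuous g) {x : ℝ} (hx : 0 < x) :
    HasDerivAt (Jf (ν + 1) g) (Jf ν g x) x := by
  have hc := Jf_cont hν hg
  have h1 : HasDerivAt (fun y => ∫ t in (0:ℝ)..y, Jf ν g t) (Jf ν g x) x := by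
    refine intervalIntegral.integral_hasDerivAt_right ?_ ?_ (hc.continuousAt (Ici_mem_nhds hx))
    · refine (hc.mono ?_).intervalIntegrable
      rw [uIcc_of_le hx.le]; exact fun t ht => ht.1
    · exact (hc.mono Ioi_subset_Ici_self).stronglyMeasurableAtFilter isOpen_Ioi x hx
  refine h1.congr_of_eventuallyEq ?_
  filter_upwards [Ioi_mem_nhds hx] with y hy
  rw [add_comm, ← semigroup one_pos hν hg hy, Jf_one]

lemma iter_lemma (s : Set ℝ) (hs : UniqueDiffOn ℝ s) (m : ℕ) (h : ℕ → ℝ → ℝ)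
    (hd : ∀ k < m, ∀ x ∈ s, HasDerivWithinAt (h k) (h (k+1) x) s x)
    (hc : ContinuousOn (h m) s) :
    ContDiffOn ℝ m (h 0) s ∧ ∀ x ∈ s, iteratedDerivWithin m (h 0) s x = h m x := by
  have key : ∀ k ≤ m, EqOn (iteratedDerivWithin k (h 0) s) (h k) s := by
    intro k
    induction k with
    | zero => intro _ x _; simp
    | succ k ih =>
      intro hk x hx
      rw [iteratedDerivWithin_succ, derivWithin_congr (ih (by omega)) (ih (by omega) hx)]
      exact (hd k (by omega) x hx).derivWithin (hs x hx)
  refine ⟨?_, fun x hx => key m le_rfl hx⟩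
  refine contDiffOn_of_continuousOn_differentiableOn_deriv (n := (m : ℕ∞)) ?_ ?_
  · intro k hk
    have hk : k ≤ m := by exact_mod_cast hk
    refine ContinuousOn.congr ?_ (key k hk)
    rcases hk.eq_or_lt with rfl | hk
    · exact hc
    · exact fun x hx => (hd k hk x hx).continuousWithinAt
  · intro k hk
    have hk : k < m := by exact_mod_cast hk
    exact DifferentiableOn.congr (fun x hx => (hd k hk x hx).differentiableWithinAt) (key k hk.le)

lemma phi_one : phi 1 = ind (fun _ => 1) := by
  unfold phi; simp

/-- Riemann-Liouville integral of a primitive. -/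
lemma Jf_prim {ν : ℝ} (hν : 0 < ν) {g : ℝ → ℝ} (hg : Continuous g) (c : ℝ) {x : ℝ} (hx : 0 < x) :
    Jf ν (fun t => c + ∫ s in (0:ℝ)..t, g s) x = c * phi (ν + 1) x + Jf (ν + 1) g x := by
  rw [← semigroup hν one_pos hg hx, Jf_eq_conv hx, Jf_eq_conv hx]
  have : ind (fun t => c + ∫ s in (0:ℝ)..t, g s) = c • phi 1 + ind (Jf 1 g) := by
    rw [phi_one]; ext t
    by_cases ht : 0 < t <;> simp [ind, ht, Jf_one]
  rw [this, ConvolutionExistsAt.distrib_add, convolution_smul, phi_conv hν one_pos]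
  · rfl
  · have := (phi_conv_exists hν one_pos x)
    unfold ConvolutionExistsAt at this ⊢
    refine (this.const_mul c).congr (Eventually.of_forall fun t => ?_)
    simp; ring
  · exact conv_exists hν (Jf_cont one_pos hg) x

lemma phi_deriv {ν : ℝ} (hν : 0 < ν) {x : ℝ} (hx : 0 < x) : HasDerivAt (phi (ν + 1)) (phi ν x) x := by
  have h := (Real.hasDerivAt_rpow_const (x := x) (p := ν) (Or.inl hx.ne')).div_const
    (Real.Gamma (ν + 1))
  have h2 : ν * x ^ (ν - 1) / Real.Gamma (ν + 1) = phi ν x := by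
    rw [phi_of_pos hx, Real.Gamma_add_one hν.ne']
    have := Real.Gamma_pos_of_pos hν
    field_simp
  rw [h2] at h
  refine h.congr_of_eventuallyEq ?_
  filter_upwards [Ioi_mem_nhds hx] with y hy
  rw [phi_of_pos hy, add_sub_cancel_right]

/-- The Riemann-Liouville derivative part, inverted. -/
lemma Jf_inv {β : ℝ} (h0 : 0 < β) (h1 : β < 1) {g : ℝ → ℝ} (hg : Continuous g) (c : ℝ) {x : ℝ}
    (hx : 0 < x) :
    Jf (1 - β) (fun t => c * phi β t + Jf β g t) x = c + ∫ s in (0:ℝ)..x, g s := by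
  have h1' : 0 < 1 - β := by linarith
  have e : 1 - β + β = 1 := by ring
  rw [Jf_eq_conv hx]
  have : ind (fun t => c * phi β t + Jf β g t) = c • phi β + ind (Jf β g) := by
    ext t
    by_cases ht : 0 < t <;> simp [ind, ht, phi]
  rw [this, ConvolutionExistsAt.distrib_add, convolution_smul, phi_conv h1' h0, ← Jf_eq_conv hx,
    semigroup h1' h0 hg hx, e, Jf_one, phi_one]
  · simp [ind, hx]
  · have := (phi_conv_exists h1' h0 x)
    unfold ConvolutionExistsAt at this ⊢
    refine (this.const_mul c).congr (Eventually.of_forall fun t => ?_)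
    simp; ring
  · exact conv_exists h1' (Jf_cont h0 hg) x

lemma Jf_congr {ν x : ℝ} (hx : 0 < x) {g h : ℝ → ℝ} (hgh : EqOn g h (Ioc 0 x)) :
    Jf ν g x = Jf ν h x := by
  unfold Jf
  rw [intervalIntegral.integral_of_le hx.le, intervalIntegral.integral_of_le hx.le]
  congr 1
  refine setIntegral_congr_fun measurableSet_Ioc fun t ht => ?_
  simp only [hgh ht]

theorem caputo_deriv_frac_integral
    (m : ℕ) (hm : 1 ≤ m) (α : ℝ) (hα₁ : (m : ℝ) - 1 < α) (hα₂ : α < m)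
    (f : ℝ → ℝ) (hf : ContDiffOn ℝ m f (Set.Icc 0 1))
    (F : ℝ → ℝ)
    (hF : ∀ s : ℝ, F s = (1 / Real.Gamma α) * ∫ t in (0 : ℝ)..s, (s - t) ^ (α - 1) * f t) :
    ContDiffOn ℝ m F (Set.Ioc 0 1) ∧
    ∀ x ∈ Set.Ioc (0 : ℝ) 1,
      (1 / Real.Gamma ((m : ℝ) - α)) *
          ∫ t in (0 : ℝ)..x, (x - t) ^ ((m : ℝ) - α - 1) *
            iteratedDerivWithin m F (Set.Ioc 0 1) t = f x := by
  obtain ⟨n, rfl⟩ : ∃ n, m = n + 1 := ⟨m - 1, by omega⟩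
  push_cast at hα₁ hα₂
  obtain ⟨β, rfl⟩ : ∃ β, α = β + n := ⟨α - n, by ring⟩
  have hβ0 : 0 < β := by linarith
  have hβ1 : β < 1 := by linarith
  have hf1 : ContDiffOn ℝ 1 f (Icc 0 1) := hf.of_le (by exact_mod_cast hm)
  have hu : UniqueDiffOn ℝ (Icc (0:ℝ) 1) := uniqueDiffOn_Icc one_pos
  have hd : ContinuousOn (derivWithin f (Icc 0 1)) (Icc 0 1) :=
    hf1.continuousOn_derivWithin hu le_rfl
  set g : ℝ → ℝ := IccExtend (zero_le_one' ℝ) ((Icc 0 1).domRestrict (derivWithin f (Icc 0 1))) with hgdef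
  have hg : Continuous g := hd.domRestrict.Icc_extend'
  have hgeq : ∀ t ∈ Icc (0:ℝ) 1, g t = derivWithin f (Icc 0 1) t := fun t ht => by
    rw [hgdef, IccExtend_of_mem _ _ ht]; rfl
  set ft : ℝ → ℝ := fun t => f 0 + ∫ s in (0:ℝ)..t, g s with hft
  have hftc : Continuous ft :=
    continuous_const.add (intervalIntegral.continuous_primitive (fun a b => hg.intervalIntegrable a b) 0)
  have hfteq : ∀ t ∈ Icc (0:ℝ) 1, ft t = f t := by
    intro x hx
    have := intervalIntegral.integral_eq_sub_of_hasDeriv_right_of_le (f := f) (f' := g) hx.1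
      (hf1.continuousOn.mono (Icc_subset_Icc_right hx.2)) (fun t ht => ?_)
      (hg.intervalIntegrable 0 x)
    · rw [hft]; simp only; rw [this]; ring
    · have ht' : t ∈ Icc (0:ℝ) 1 := ⟨ht.1.le, ht.2.le.trans hx.2⟩
      rw [hgeq t ht']
      have h1 := (hf1.differentiableOn one_ne_zero t ht').hasDerivWithinAt
      exact (h1.hasDerivAt (Icc_mem_nhds ht.1 (ht.2.trans_le hx.2))).hasDerivWithinAt
  have hus : UniqueDiffOn ℝ (Ioc (0:ℝ) 1) := uniqueDiffOn_Ioc 0 1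
  let h : ℕ → ℝ → ℝ := fun k =>
    if k ≤ n then Jf (β + ((n - k : ℕ) : ℝ)) ft else fun t => f 0 * phi β t + Jf β g t
  have hFh : EqOn F (h 0) (Ioc 0 1) := by
    intro x hx
    rw [hF]
    simp only [h, zero_le, if_true, Nat.sub_zero]
    exact Jf_congr hx.1 fun t ht => (hfteq t ⟨ht.1.le, ht.2.trans hx.2⟩).symm
  have hlast : h (n+1) = fun t => f 0 * phi β t + Jf β g t := by simp [h]
  obtain ⟨hA, hB⟩ := iter_lemma (Ioc 0 1) hus (n+1) h (by
    intro k hk x hx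
    refine HasDerivAt.hasDerivWithinAt ?_
    rcases (Nat.lt_succ_iff.1 hk).eq_or_lt with rfl | hk
    · rw [hlast]
      have e : h k = Jf β ft := by simp [h]
      rw [e]
      have := ((phi_deriv hβ0 hx.1).const_mul (f 0)).add (Jf_deriv hβ0 hg hx.1)
      refine this.congr_of_eventuallyEq ?_
      filter_upwards [Ioi_mem_nhds hx.1] with y hy
      exact Jf_prim hβ0 hg (f 0) hy
    · have e1 : h k = Jf ((β + ((n - (k+1) : ℕ) : ℝ)) + 1) ft := by
        have : n - k = n - (k+1) + 1 := by omega
        simp only [h, if_pos hk.le]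
        rw [this]; push_cast; rw [add_assoc]
      have e2 : h (k+1) = Jf (β + ((n - (k+1) : ℕ) : ℝ)) ft := by
        simp only [h]; rw [if_pos (by omega)]
      rw [e1, e2]
      exact Jf_deriv (by positivity) hftc hx.1) (by
    rw [hlast]
    refine ContinuousOn.add (continuousOn_const.mul ?_) ((Jf_cont hβ0 hg).mono fun t ht => ht.1.le)
    have : ContinuousOn (fun t : ℝ => t ^ (β - 1) / Real.Gamma β) (Ioc 0 1) := by
      refine ContinuousOn.div_const (fun t ht => ?_) _
      exact (Real.continuousAt_rpow_const _ _ (Or.inl ht.1.ne')).continuousWithinAt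
    exact this.congr fun t ht => phi_of_pos ht.1)
  refine ⟨hA.congr hFh, fun x hx => ?_⟩
  have e : ((n + 1 : ℕ) : ℝ) - (β + n) = 1 - β := by push_cast; ring
  rw [e]
  change Jf (1 - β) _ x = f x
  rw [← hfteq x ⟨hx.1.le, hx.2⟩, hft]
  simp only
  rw [← Jf_inv hβ0 hβ1 hg (f 0) hx.1]
  refine Jf_congr hx.1 fun t ht => ?_
  have ht' : t ∈ Ioc (0:ℝ) 1 := ⟨ht.1, ht.2.trans hx.2⟩
  rw [iteratedDerivWithin_congr hFh ht', hB t ht', hlast]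
end

section
/- Let m ≥ 1 be a natural number, α real with m − 1 < α < m, λ ∈ ℝ, q ≥ 1 a natural number, f : ℝ → ℝ continuous on [0,1], k : ℝ × ℝ → ℝ continuous on [0,1]×[0,1], and d_0, …, d_{m−1} ∈ ℝ. Suppose y : ℝ → ℝ is m-times continuously differentiable on [0,1], y^{(i)}(0) = d_i for i = 0, …, m−1, and for every x ∈ [0,1], (1/Γ(m−α)) ∫_0^x (x−t)^{m−α−1} y^{(m)}(t) dt = λ ∫_0^1 k(x,t) (y(t))^q dt + f(x). Then for every x ∈ [0,1], y(x) = ∑_{k=0}^{m−1} d_k x^k/k! + (1/Γ(α)) ∫_0^x (x−s)^{α−1} f(s) ds + (λ/Γ(α)) ∫_0^x (x−s)^{α−1} (∫_0^1 k(s,t) (y(t))^q dt) ds. -/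
section aux
open MeasureTheory Set

lemma aux_beta {a b t x : ℝ} (ha : 0 < a) (hb : 0 < b) (htx : t < x) :
    ∫ s in t..x, (x - s) ^ (a - 1) * (s - t) ^ (b - 1)
      = ProbabilityTheory.beta a b * (x - t) ^ (a + b - 1) := by
  have hc : 0 < x - t := sub_pos.2 htx
  have h1 : ∫ s in t..x, (x - s) ^ (a - 1) * (s - t) ^ (b - 1)
      = ∫ u in (0:ℝ)..(x - t), u ^ (b - 1) * ((x - t) - u) ^ (a - 1) := by
    have := intervalIntegral.integral_comp_sub_right (a := t) (b := x)
      (fun u : ℝ => u ^ (b - 1) * ((x - t) - u) ^ (a - 1)) t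
    rw [sub_self] at this
    rw [← this]
    congr 1; ext s
    rw [mul_comm]; congr 2; ring
  rw [h1]
  have h2 := Complex.betaIntegral_scaled (b : ℂ) (a : ℂ) hc
  have h3 : ∫ u in (0:ℝ)..(x - t), (u : ℂ) ^ ((b : ℂ) - 1) * (((x - t : ℝ) : ℂ) - u) ^ ((a : ℂ) - 1)
      = ((∫ u in (0:ℝ)..(x - t), u ^ (b - 1) * ((x - t) - u) ^ (a - 1) : ℝ) : ℂ) := by
    rw [← intervalIntegral.integral_ofReal]
    apply intervalIntegral.integral_congr
    intro u hu
    rw [uIcc_of_le hc.le] at hu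
    simp only
    rw [Complex.ofReal_mul, Complex.ofReal_cpow hu.1, Complex.ofReal_cpow (sub_nonneg.2 hu.2)]
    push_cast; rfl
  rw [h3] at h2
  have h4 : Complex.betaIntegral (b : ℂ) (a : ℂ) = ((ProbabilityTheory.beta a b : ℝ) : ℂ) := by
    rw [Complex.betaIntegral_eq_Gamma_mul_div _ _ (by simpa) (by simpa)]
    simp_rw [ProbabilityTheory.beta, ← Complex.ofReal_add, Complex.Gamma_ofReal]
    push_cast
    rw [mul_comm, add_comm]
  rw [h4] at h2
  have h5 : ((x - t : ℝ) : ℂ) ^ ((b : ℂ) + a - 1) = (((x - t) ^ (a + b - 1) : ℝ) : ℂ) := by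
    rw [Complex.ofReal_cpow hc.le]; push_cast; rw [add_comm (b : ℂ)]
  rw [h5, ← Complex.ofReal_mul] at h2
  rw [Complex.ofReal_injective h2, mul_comm]

lemma aux_int {a b t x : ℝ} (ha : 0 < a) (hb : 0 < b) (htx : t < x) :
    IntervalIntegrable (fun s => (x - s) ^ (a - 1) * (s - t) ^ (b - 1)) volume t x := by
  by_contra h
  have h1 := intervalIntegral.integral_undef h
  rw [aux_beta ha hb htx] at h1
  have := mul_pos (ProbabilityTheory.beta_pos ha hb) (Real.rpow_pos_of_pos (sub_pos.2 htx) (a + b - 1))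
  linarith

lemma aux_pow_int {a x : ℝ} (ha : 0 < a) {g : ℝ → ℝ} (hg : ContinuousOn g (uIcc 0 x)) :
    IntervalIntegrable (fun s => (x - s) ^ (a - 1) * g s) volume 0 x := by
  refine IntervalIntegrable.mul_continuousOn ?_ hg
  have := (intervalIntegral.intervalIntegrable_rpow' (a := 0) (b := x) (r := a - 1)
    (by linarith)).comp_sub_left x
  simpa using this.symm

lemma aux_semigroup {a b x : ℝ} (ha : 0 < a) (hb : 0 < b) (hx : 0 < x) {g : ℝ → ℝ}
    (hg : Continuous g) :
    ∫ s in (0:ℝ)..x, (x - s) ^ (a - 1) * ∫ t in (0:ℝ)..s, (s - t) ^ (b - 1) * g t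
      = ProbabilityTheory.beta a b * ∫ t in (0:ℝ)..x, (x - t) ^ (a + b - 1) * g t := by
  set ν := volume.restrict (Ioc 0 x) with hν
  let F : ℝ → ℝ → ℝ := fun s t =>
    if t < s then (x - s) ^ (a - 1) * (s - t) ^ (b - 1) * g t else 0
  have hmeas : Measurable (Function.uncurry F) := by
    apply Measurable.ite (measurableSet_lt measurable_snd measurable_fst)
    · have := hg.measurable
      fun_prop
    · exact measurable_const
  -- inner slices
  have hslice : ∀ G : ℝ → ℝ, ∀ t ∈ Ioc 0 x, 
      (fun s => if t < s then (x - s) ^ (a - 1) * (s - t) ^ (b - 1) * G t else 0)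
       = indicator (Ioi t) (fun s => (x - s) ^ (a - 1) * (s - t) ^ (b - 1) * G t) := by
    intro G t ht; ext s; simp [indicator]
  have hset : ∀ t ∈ Ioc 0 x, Ioi t ∩ Ioc 0 x = Ioc t x := by
    intro t ht; ext s; simp only [mem_inter_iff, mem_Ioi, mem_Ioc] at *
    constructor
    · rintro ⟨h1, h2, h3⟩; exact ⟨h1, h3⟩
    · rintro ⟨h1, h3⟩; exact ⟨h1, by linarith, h3⟩
  have hsint : ∀ G : ℝ → ℝ, ∀ t ∈ Ioc 0 x, t ≠ x → Integrable
      (fun s => if t < s then (x - s) ^ (a - 1) * (s - t) ^ (b - 1) * G t else 0) ν := by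
    intro G t ht htx
    have htx : t < x := lt_of_le_of_ne ht.2 htx
    rw [hslice G t ht, integrable_indicator_iff measurableSet_Ioi, IntegrableOn, hν,
      Measure.restrict_restrict measurableSet_Ioi, hset t ht]
    exact (((intervalIntegrable_iff_integrableOn_Ioc_of_le htx.le).1 (aux_int ha hb htx))).mul_const _
  have hsval : ∀ G : ℝ → ℝ, ∀ t ∈ Ioc 0 x, t ≠ x → ∫ s, 
      (if t < s then (x - s) ^ (a - 1) * (s - t) ^ (b - 1) * G t else 0) ∂ν
      = ProbabilityTheory.beta a b * ((x - t) ^ (a + b - 1) * G t) := by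
    intro G t ht htx
    have htx : t < x := lt_of_le_of_ne ht.2 htx
    rw [hslice G t ht, integral_indicator measurableSet_Ioi, hν,
      Measure.restrict_restrict measurableSet_Ioi, hset t ht, integral_mul_const,
      ← intervalIntegral.integral_of_le htx.le, aux_beta ha hb htx, mul_assoc]
  have hae : ∀ᵐ t ∂ν, t ∈ Ioc 0 x ∧ t ≠ x := by
    filter_upwards [ae_restrict_mem measurableSet_Ioc,
      ae_restrict_of_ae (Measure.ae_ne volume x)] with t h1 h2 using ⟨h1, h2⟩
  have hpow : ∀ G : ℝ → ℝ, Continuous G →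
      Integrable (fun t => ProbabilityTheory.beta a b * ((x - t) ^ (a + b - 1) * G t)) ν := by
    intro G hG
    exact ((intervalIntegrable_iff_integrableOn_Ioc_of_le hx.le).1
      (aux_pow_int (add_pos ha hb) hG.continuousOn)).const_mul _
  have hI : Integrable (Function.uncurry F) (ν.prod ν) := by
    rw [integrable_prod_iff' hmeas.aestronglyMeasurable]
    constructor
    · filter_upwards [hae] with t ht
      exact hsint g t ht.1 ht.2
    · refine (hpow (fun t => |g t|) hg.abs).congr ?_
      filter_upwards [hae] with t ht
      refine (hsval (fun t => |g t|) t ht.1 ht.2).symm.trans ?_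
      apply integral_congr_ae
      filter_upwards [ae_restrict_mem measurableSet_Ioc] with s hs
      simp only [Function.uncurry, F, Real.norm_eq_abs]
      split_ifs with h
      · rw [abs_mul, abs_mul, abs_of_nonneg (Real.rpow_nonneg (sub_nonneg.2 hs.2) _),
          abs_of_nonneg (Real.rpow_nonneg (sub_nonneg.2 h.le) _)]
      · simp
  have hsw := integral_integral_swap hI
  rw [intervalIntegral.integral_of_le hx.le, intervalIntegral.integral_of_le hx.le,
    ← integral_const_mul]
  calc _ = ∫ s, ∫ t, F s t ∂ν ∂ν := by
        apply integral_congr_ae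
        filter_upwards [ae_restrict_mem measurableSet_Ioc] with s hs
        have e1 : F s = indicator (Iio s)
            (fun t => (x - s) ^ (a - 1) * ((s - t) ^ (b - 1) * g t)) := by
          ext t; simp [F, indicator, mul_assoc]
        have e2 : Iio s ∩ Ioc 0 x = Ioo 0 s := by
          ext t; simp only [mem_inter_iff, mem_Iio, mem_Ioc, mem_Ioo] at *
          constructor
          · rintro ⟨h1, h2, h3⟩; exact ⟨h2, h1⟩
          · rintro ⟨h1, h3⟩; exact ⟨h3, h1, by linarith⟩
        rw [e1, integral_indicator measurableSet_Iio, hν,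
          Measure.restrict_restrict measurableSet_Iio, e2, integral_const_mul,
          intervalIntegral.integral_of_le hs.1.le, integral_Ioc_eq_integral_Ioo]
    _ = ∫ t, ∫ s, F s t ∂ν ∂ν := hsw
    _ = _ := by
        apply integral_congr_ae
        filter_upwards [hae] with t ht
        exact hsval g t ht.1 ht.2

lemma aux_taylor {n : ℕ} {y : ℝ → ℝ} (hy : ContDiffOn ℝ (n + 1 : ℕ) y (Icc 0 1)) {x : ℝ}
    (hx0 : 0 < x) (hx1 : x ≤ 1) :
    y x = (∑ j ∈ Finset.range (n + 1),
        iteratedDerivWithin j y (Icc 0 1) 0 * x ^ j / j.factorial) +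
      (1 / n.factorial) * ∫ t in (0:ℝ)..x, (x - t) ^ n *
        iteratedDerivWithin (n + 1) y (Icc 0 1) t := by
  have hsub : uIcc 0 x ⊆ Icc (0:ℝ) 1 := by
    rw [uIcc_of_le hx0.le]; exact Icc_subset_Icc le_rfl hx1
  have hD : ∀ j ≤ n + 1, ∀ t ∈ uIcc 0 x,
      iteratedDerivWithin j y (uIcc 0 x) t = iteratedDerivWithin j y (Icc 0 1) t := by
    intro j hj t ht
    rw [iteratedDerivWithin, iteratedDerivWithin, iteratedFDerivWithin_subset hsub
      (uniqueDiffOn_uIcc hx0.ne) (uniqueDiffOn_Icc zero_lt_one)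
      (hy.of_le (by exact_mod_cast hj)) ht]
  have h := taylor_integral_remainder (hy.mono hsub)
  rw [taylor_within_apply, sub_eq_iff_eq_add'] at h
  rw [h, ← intervalIntegral.integral_const_mul]
  congr 1
  · apply Finset.sum_congr rfl
    intro j hj
    rw [hD j (Finset.mem_range.1 hj).le 0 left_mem_uIcc, smul_eq_mul, sub_zero]
    ring
  · apply intervalIntegral.integral_congr
    intro t ht
    simp only [smul_eq_mul]
    rw [hD _ le_rfl t ht]
    ring

lemma aux_param {k : ℝ × ℝ → ℝ} (hk : ContinuousOn k (Icc 0 1 ×ˢ Icc 0 1)) {w : ℝ → ℝ}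
    (hw : ContinuousOn w (Icc 0 1)) :
    ContinuousOn (fun s => ∫ t in (0:ℝ)..1, k (s, t) * w t) (Icc 0 1) := by
  let p : ℝ → ℝ := fun s => (projIcc (0:ℝ) 1 zero_le_one s : ℝ)
  have hp : Continuous p := continuous_subtype_val.comp continuous_projIcc
  have hpm : ∀ s, p s ∈ Icc (0:ℝ) 1 := fun s => (projIcc (0:ℝ) 1 zero_le_one s).2
  have hpe : ∀ s ∈ Icc (0:ℝ) 1, p s = s := fun s hs => by simp [p, projIcc_of_mem _ hs]
  have h1 : Continuous (Function.uncurry fun s t => k (p s, p t) * w (p t)) := by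
    apply Continuous.mul
    · exact hk.comp_continuous (f := fun z : ℝ × ℝ => (p z.1, p z.2)) (by fun_prop)
        (fun z => ⟨hpm _, hpm _⟩)
    · exact hw.comp_continuous (f := fun z : ℝ × ℝ => p z.2) (by fun_prop) (fun z => hpm _)
  have h2 := intervalIntegral.continuous_parametric_intervalIntegral_of_continuous'
    (μ := volume) h1 0 1
  refine h2.continuousOn.congr ?_
  intro s hs
  apply intervalIntegral.integral_congr
  intro t ht
  rw [uIcc_of_le zero_le_one] at ht
  simp only [hpe s hs, hpe t ht]

end aux

/-- Equivalence (forward direction) between the nonlinear Fredholm fractional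
integro-differential equation `D^α y(x) - λ ∫_0^1 k(x,t) y(t)^q dt = f(x)` with initial
values `y^(i)(0) = d_i` and the nonlinear integral equation. -/
theorem nfide_to_integral_equation
    (m : ℕ) (hm : 1 ≤ m) (α : ℝ) (hα₁ : (m : ℝ) - 1 < α) (hα₂ : α < m)
    (lam : ℝ) (q : ℕ) (hq : 1 ≤ q)
    (f : ℝ → ℝ) (hf : ContinuousOn f (Set.Icc 0 1))
    (k : ℝ × ℝ → ℝ) (hk : ContinuousOn k (Set.Icc 0 1 ×ˢ Set.Icc 0 1))
    (d : ℕ → ℝ)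
    (y : ℝ → ℝ) (hy : ContDiffOn ℝ m y (Set.Icc 0 1))
    (hinit : ∀ i < m, iteratedDerivWithin i y (Set.Icc 0 1) 0 = d i)
    (heq : ∀ x ∈ Set.Icc (0 : ℝ) 1,
      (1 / Real.Gamma ((m : ℝ) - α)) *
          ∫ t in (0 : ℝ)..x, (x - t) ^ ((m : ℝ) - α - 1) *
            iteratedDerivWithin m y (Set.Icc 0 1) t =
        lam * (∫ t in (0 : ℝ)..1, k (x, t) * y t ^ q) + f x) :
    ∀ x ∈ Set.Icc (0 : ℝ) 1,
      y x = (∑ j ∈ Finset.range m, d j * x ^ j / j.factorial) +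
        (1 / Real.Gamma α) * (∫ s in (0 : ℝ)..x, (x - s) ^ (α - 1) * f s) +
        (lam / Real.Gamma α) *
          ∫ s in (0 : ℝ)..x, (x - s) ^ (α - 1) *
            ∫ t in (0 : ℝ)..1, k (s, t) * y t ^ q := by
  rintro x ⟨hx0, hx1⟩
  obtain ⟨n, rfl⟩ : ∃ n, m = n + 1 := ⟨m - 1, by omega⟩
  have hα : 0 < α := by
    have : (0:ℝ) ≤ n := Nat.cast_nonneg n
    push_cast at hα₁; linarith
  have hβ : 0 < ((n + 1 : ℕ) : ℝ) - α := sub_pos.2 hα₂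
  rcases hx0.eq_or_lt with rfl | hx0
  · have h0 := hinit 0 (by omega)
    rw [iteratedDerivWithin_zero] at h0
    simp [Finset.sum_range_succ', h0]
  have hsub : Set.uIcc 0 x ⊆ Set.Icc (0:ℝ) 1 := by
    rw [Set.uIcc_of_le hx0.le]; exact Set.Icc_subset_Icc le_rfl hx1
  set g := iteratedDerivWithin (n + 1) y (Set.Icc 0 1) with hg
  have hgc : ContinuousOn g (Set.Icc 0 1) :=
    hy.continuousOn_iteratedDerivWithin le_rfl (uniqueDiffOn_Icc zero_lt_one)
  obtain ⟨G, hGc, hGe⟩ : ∃ G : ℝ → ℝ, Continuous G ∧ ∀ t ∈ Set.Icc (0:ℝ) 1, G t = g t :=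
    ⟨Set.IccExtend zero_le_one ((Set.Icc 0 1).domRestrict g), hgc.domRestrict.Icc_extend',
      fun t ht => by rw [Set.IccExtend_of_mem _ _ ht]; rfl⟩
  have hK := aux_param hk (w := fun t => y t ^ q) (hy.continuousOn.pow q)
  have hT := aux_taylor hy hx0 hx1
  rw [← hg] at hT
  have hS := aux_semigroup hα hβ hx0 hGc
  have hΓα := (Real.Gamma_pos_of_pos hα).ne'
  have hΓβ := (Real.Gamma_pos_of_pos hβ).ne'
  have hfac : ((n.factorial : ℕ) : ℝ) ≠ 0 := by exact_mod_cast n.factorial_ne_zero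
  have hbeta : ProbabilityTheory.beta α (((n + 1 : ℕ) : ℝ) - α) =
      Real.Gamma α * Real.Gamma (((n + 1 : ℕ) : ℝ) - α) / n.factorial := by
    rw [ProbabilityTheory.beta, add_sub_cancel]
    push_cast
    rw [Real.Gamma_nat_eq_factorial]
  have hR : ∫ t in (0:ℝ)..x, (x - t) ^ (α + (((n + 1 : ℕ) : ℝ) - α) - 1) * G t
      = ∫ t in (0:ℝ)..x, (x - t) ^ n * g t := by
    apply intervalIntegral.integral_congr
    intro t ht
    simp only
    rw [hGe t (hsub ht), add_sub_cancel]
    push_cast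
    rw [add_sub_cancel_right, Real.rpow_natCast]
  have hL : ∫ s in (0:ℝ)..x, (x - s) ^ (α - 1) *
        ∫ t in (0:ℝ)..s, (s - t) ^ (((n + 1 : ℕ) : ℝ) - α - 1) * G t
      = Real.Gamma (((n + 1 : ℕ) : ℝ) - α) *
        (lam * (∫ s in (0 : ℝ)..x, (x - s) ^ (α - 1) *
            ∫ t in (0 : ℝ)..1, k (s, t) * y t ^ q)
          + ∫ s in (0 : ℝ)..x, (x - s) ^ (α - 1) * f s) := by
    rw [← intervalIntegral.integral_const_mul, ← intervalIntegral.integral_add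
      ((aux_pow_int hα (hK.mono hsub)).const_mul lam) (aux_pow_int hα (hf.mono hsub)),
      ← intervalIntegral.integral_const_mul]
    apply intervalIntegral.integral_congr
    intro s hs
    have hs' := hsub hs
    have e := heq s hs'
    have e2 : ∫ t in (0:ℝ)..s, (s - t) ^ (((n + 1 : ℕ) : ℝ) - α - 1) * G t
        = ∫ t in (0:ℝ)..s, (s - t) ^ (((n + 1 : ℕ) : ℝ) - α - 1) * g t := by
      apply intervalIntegral.integral_congr
      intro t ht
      rw [Set.uIcc_of_le hs'.1] at ht
      simp only
      rw [hGe t ⟨ht.1, ht.2.trans hs'.2⟩]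
    have e3 : ∫ t in (0:ℝ)..s, (s - t) ^ (((n + 1 : ℕ) : ℝ) - α - 1) * g t
        = Real.Gamma (((n + 1 : ℕ) : ℝ) - α) *
          (lam * (∫ t in (0 : ℝ)..1, k (s, t) * y t ^ q) + f s) := by
      rw [← e, ← mul_assoc, mul_one_div_cancel hΓβ, one_mul]
    simp only
    rw [e2, e3]
    ring
  rw [hL, hR, hbeta] at hS
  have hsum : (∑ j ∈ Finset.range (n + 1),
        iteratedDerivWithin j y (Set.Icc 0 1) 0 * x ^ j / j.factorial)
      = ∑ j ∈ Finset.range (n + 1), d j * x ^ j / j.factorial :=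
    Finset.sum_congr rfl fun j hj => by rw [hinit j (Finset.mem_range.1 hj)]
  rw [hT, hsum, add_assoc]
  congr 1
  generalize (∫ t in (0:ℝ)..x, (x - t) ^ n * g t) = A at *
  generalize (∫ s in (0 : ℝ)..x, (x - s) ^ (α - 1) *
            ∫ t in (0 : ℝ)..1, k (s, t) * y t ^ q) = B at *
  generalize (∫ s in (0 : ℝ)..x, (x - s) ^ (α - 1) * f s) = C at *
  have h6 : lam * B + C = Real.Gamma α / n.factorial * A := by
    apply mul_left_cancel₀ hΓβ
    rw [hS]; ring
  have h7 : 1 / Real.Gamma α * C + lam / Real.Gamma α * B = (lam * B + C) / Real.Gamma α := by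
    ring
  rw [h7, h6]
  field_simp
end
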